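/- For all real numbers x, y, q, the double series R(x,y;q) := Σ_{n ≥ 0} (xⁿ/n!) Σ_{k=0}^{n} y^k · (Σ_{π ∈ R_{n,k}} q^{F_π}) converges absolutely (the n = 0, k = 0 term being 1, for the empty sequence), and R(x,y;q) = e^{y(e^x − 1)} + ∫_0^x (q − 1)·y·e^{(x−t) + (1 + q·t)·y·e^{x−t} − y} dt. -/

import Mathlib

open Finset
open scoped Classical

/-- `π : Fin n → ℕ` is a restricted growth sequence (entries are positive, the first entry
is `1`, and each entry exceeds the maximum of the previous entries by at most `1`;
equivalently `π₁ = 1` and `π_{j+1} ≤ 1 + max {π₁, …, π_j}`). -/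
def IsRGS {n : ℕ} (π : Fin n → ℕ) : Prop :=
  ∀ i : Fin n, 1 ≤ π i ∧ π i ≤ (Finset.univ.filter (fun j : Fin n => j < i)).sup π + 1

/-- The (finite) set `R_n` of restricted growth sequences of length `n`
(all such sequences take values in `{1, …, n}`). -/
noncomputable def RGS (n : ℕ) : Finset (Fin n → ℕ) :=
  (Fintype.piFinset fun _ : Fin n => Finset.Icc 1 n).filter IsRGS

/-- The (finite) set `R_{n,k}` of restricted growth sequences of length `n`
with maximal letter `k`. -/
noncomputable def RGSk (n k : ℕ) : Finset (Fin n → ℕ) :=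
  (RGS n).filter (fun π => Finset.univ.sup π = k)

/-- `F_π`: the number of fixed points of `π`, i.e. (1-indexed) positions `i` with `π_i = i`. -/
def fixCount {n : ℕ} (π : Fin n → ℕ) : ℕ :=
  (Finset.univ.filter (fun i : Fin n => π i = (i : ℕ) + 1)).card

theorem IsRGS.le_succ {n : ℕ} {π : Fin n → ℕ} (h : IsRGS π) (i : Fin n) : π i ≤ i + 1 := by
  induction i using WellFoundedLT.induction with
  | ind i ih =>
    refine (h i).2.trans (Nat.add_le_add_right (Finset.sup_le fun j hj => ?_) 1)
    have hji : j < i := by simpa using hj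
    exact (ih j hji).trans hji

theorem mem_RGS {n : ℕ} {π : Fin n → ℕ} : π ∈ RGS n ↔ IsRGS π := by
  refine ⟨fun h => (mem_filter.1 h).2, fun h => mem_filter.2 ⟨?_, h⟩⟩
  exact Fintype.mem_piFinset.2 fun i => mem_Icc.2 ⟨(h i).1, (h.le_succ i).trans i.2⟩

theorem sup_le_of_mem_RGS {n : ℕ} {π : Fin n → ℕ} (h : π ∈ RGS n) : univ.sup π ≤ n :=
  Finset.sup_le fun i _ => ((mem_RGS.1 h).le_succ i).trans i.2

theorem sup_snoc {n : ℕ} (π : Fin n → ℕ) (v : ℕ) :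
    univ.sup (Fin.snoc π v : Fin (n + 1) → ℕ) = univ.sup π ⊔ v := by
  refine eq_of_forall_ge_iff fun c => ?_
  simp [Fin.forall_fin_succ']

theorem isRGS_snoc {n : ℕ} {π : Fin n → ℕ} {v : ℕ} :
    IsRGS (Fin.snoc π v : Fin (n + 1) → ℕ) ↔ IsRGS π ∧ 1 ≤ v ∧ v ≤ univ.sup π + 1 := by
  have hcast (i : Fin n) :
      (univ.filter fun j : Fin (n + 1) => j < i.castSucc).sup (Fin.snoc π v : Fin (n + 1) → ℕ)
        = (univ.filter fun j : Fin n => j < i).sup π := by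
    refine eq_of_forall_ge_iff fun c => ?_
    simp [Fin.forall_fin_succ', not_lt.2 (Fin.castSucc_lt_last i).le]
  have hlast :
      (univ.filter fun j : Fin (n + 1) => j < Fin.last n).sup (Fin.snoc π v : Fin (n + 1) → ℕ)
        = univ.sup π := by
    refine eq_of_forall_ge_iff fun c => ?_
    simp [Fin.forall_fin_succ', Fin.castSucc_lt_last]
  simp only [IsRGS, Fin.forall_fin_succ', Fin.snoc_castSucc, Fin.snoc_last, hcast, hlast]

theorem fixCount_snoc {n : ℕ} (π : Fin n → ℕ) (v : ℕ) :
    fixCount (Fin.snoc π v : Fin (n + 1) → ℕ) = fixCount π + if v = n + 1 then 1 else 0 := by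
  simp only [fixCount, card_filter, Fin.sum_univ_castSucc, Fin.snoc_castSucc, Fin.snoc_last,
    Fin.val_castSucc, Fin.val_last]

theorem sum_RGS_succ {M : Type*} [AddCommMonoid M] (n : ℕ) (f : (Fin (n + 1) → ℕ) → M) :
    ∑ π ∈ RGS (n + 1), f π
      = ∑ π ∈ RGS n, ∑ v ∈ Icc 1 (univ.sup π + 1), f (Fin.snoc π v) := by
  rw [sum_sigma']
  refine (sum_bij' (fun p _ => Fin.snoc p.1 p.2) (fun π _ => ⟨Fin.init π, π (Fin.last n)⟩)
    ?_ ?_ ?_ ?_ ?_).symm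
  · rintro ⟨π, v⟩ h
    simpa [mem_RGS, isRGS_snoc] using h
  · intro π h
    rw [← Fin.snoc_init_self π, mem_RGS, isRGS_snoc] at h
    simpa [mem_RGS] using h
  · rintro ⟨π, v⟩ -
    simp
  · intro π _
    simp
  · intro _ _
    rfl

/-- The sum of `y ^ max * q ^ fix` over all ways of appending `m` letters to a restricted growth
sequence of length `n` with maximal letter `k` and `F` fixed points. -/
noncomputable def extensionSum (y q : ℝ) : ℕ → ℕ → ℕ → ℕ → ℝ
  | 0, _, k, F => y ^ k * q ^ F
  | m + 1, n, k, F => k * extensionSum y q m (n + 1) k F +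
      extensionSum y q m (n + 1) (k + 1) (F + if k = n then 1 else 0)

theorem sum_RGS_add (y q : ℝ) (m n : ℕ) :
    ∑ π ∈ RGS (n + m), y ^ univ.sup π * q ^ fixCount π
      = ∑ π ∈ RGS n, extensionSum y q m n (univ.sup π) (fixCount π) := by
  induction m generalizing n with
  | zero => rfl
  | succ m ih =>
    rw [show n + (m + 1) = n + 1 + m by ring, ih, sum_RGS_succ]
    refine sum_congr rfl fun π hπ => ?_
    have hle := sup_le_of_mem_RGS hπ
    rw [sum_Icc_succ_top (by lia), extensionSum]
    congr 1
    · rw [sum_congr rfl (g := fun _ => extensionSum y q m (n + 1) (univ.sup π) (fixCount π))]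
      · simp
      · intro v hv
        rw [mem_Icc] at hv
        rw [sup_snoc, fixCount_snoc, sup_eq_left.2 hv.2, if_neg (by lia), add_zero]
    · simp [sup_snoc, fixCount_snoc]

/-- The sum of `y ^ (number of new letters)` over all words of length `m` which extend a restricted
growth sequence with maximal letter `j`. -/
noncomputable def extensionPoly (y : ℝ) : ℕ → ℕ → ℝ
  | 0, _ => 1
  | m + 1, j => j * extensionPoly y m j + y * extensionPoly y m (j + 1)

theorem extensionSum_of_lt (y q : ℝ) (m : ℕ) {n k : ℕ} (F : ℕ) (h : k < n) :
    extensionSum y q m n k F = y ^ k * q ^ F * extensionPoly y m k := by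
  induction m generalizing n k with
  | zero => simp [extensionSum, extensionPoly]
  | succ m ih =>
    rw [extensionSum, extensionPoly, if_neg h.ne, ih (by lia), add_zero, ih (by lia)]
    ring

theorem extensionSum_self (y q : ℝ) (m n F : ℕ) :
    extensionSum y q m n n F = y ^ n * q ^ F * (extensionPoly y m n +
      ∑ j ∈ range m, (q - 1) * q ^ j * y ^ (j + 1) * extensionPoly y (m - 1 - j) (n + j + 1)) := by
  induction m generalizing n F with
  | zero => simp [extensionSum, extensionPoly]
  | succ m ih =>
    rw [extensionSum, extensionPoly, if_pos rfl, extensionSum_of_lt y q m F (Nat.lt_succ_self n),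
      ih, sum_range_succ']
    have hsum : ∑ j ∈ range m, (q - 1) * q ^ (j + 1) * y ^ (j + 1 + 1) *
          extensionPoly y (m + 1 - 1 - (j + 1)) (n + (j + 1) + 1)
        = q * y * ∑ j ∈ range m, (q - 1) * q ^ j * y ^ (j + 1) *
          extensionPoly y (m - 1 - j) (n + 1 + j + 1) := by
      rw [mul_sum]
      refine sum_congr rfl fun j _ => ?_
      rw [show m + 1 - 1 - (j + 1) = m - 1 - j by lia, show n + (j + 1) + 1 = n + 1 + j + 1 by ring]
      ring
    rw [hsum]
    simp only [Nat.add_sub_cancel, Nat.sub_zero, add_zero]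
    ring

theorem sum_RGSk (y q : ℝ) (n : ℕ) :
    ∑ k ∈ range (n + 1), y ^ k * ∑ π ∈ RGSk n k, q ^ fixCount π
      = extensionPoly y n 0 + ∑ j ∈ range n,
        (q - 1) * q ^ j * y ^ (j + 1) * extensionPoly y (n - 1 - j) (j + 1) := by
  have hfib : ∑ k ∈ range (n + 1), y ^ k * ∑ π ∈ RGSk n k, q ^ fixCount π
      = ∑ π ∈ RGS n, y ^ univ.sup π * q ^ fixCount π := by
    rw [← sum_fiberwise_of_maps_to (g := fun π => univ.sup π) (t := range (n + 1))
      fun π hπ => mem_range.2 (Nat.lt_succ_of_le (sup_le_of_mem_RGS hπ))]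
    refine sum_congr rfl fun k _ => ?_
    rw [mul_sum]
    refine sum_congr rfl fun π hπ => ?_
    rw [(mem_filter.1 hπ).2]
  have hzero : RGS 0 = {Fin.elim0} := by
    ext π
    simp [mem_RGS, IsRGS, eq_iff_true_of_subsingleton]
  have h := sum_RGS_add y q n 0
  rw [zero_add] at h
  rw [hfib, h, hzero, sum_singleton]
  have hs := extensionSum_self y q n 0 0
  simpa [fixCount] using hs

theorem hasSum_pow_div_factorial (a : ℝ) :
    HasSum (fun n : ℕ => a ^ n / n.factorial) (Real.exp a) := by
  rw [Real.exp_eq_exp_ℝ]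
  exact NormedSpace.expSeries_div_hasSum_exp a

theorem hasSum_dobinski (y : ℝ) (m j : ℕ) :
    HasSum (fun i : ℕ => y ^ i / i.factorial * ((i : ℝ) + j) ^ m)
      (Real.exp y * extensionPoly y m j) := by
  induction m generalizing j with
  | zero => simpa [extensionPoly] using hasSum_pow_div_factorial y
  | succ m ih =>
    have hshift : HasSum (fun i : ℕ => i * (y ^ i / i.factorial) * ((i : ℝ) + j) ^ m)
        (y * (Real.exp y * extensionPoly y m (j + 1))) := by
      rw [← hasSum_nat_add_iff' 1]
      convert! (ih (j + 1)).mul_left y using 1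
      · ext i
        rw [Nat.factorial_succ]
        push_cast
        field_simp
        ring
      · simp
    convert! ((ih j).mul_left (j : ℝ)).add hshift using 1
    · ext i
      ring
    · rw [extensionPoly]
      ring

theorem extensionPoly_nonneg {y : ℝ} (hy : 0 ≤ y) (m j : ℕ) : 0 ≤ extensionPoly y m j := by
  induction m generalizing j with
  | zero => simp [extensionPoly]
  | succ m ih =>
    have h₁ := ih j
    have h₂ := ih (j + 1)
    rw [extensionPoly]
    positivity

theorem abs_extensionPoly_le (y : ℝ) (m j : ℕ) :
    |extensionPoly y m j| ≤ extensionPoly |y| m j := by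
  induction m generalizing j with
  | zero => simp [extensionPoly]
  | succ m ih =>
    rw [extensionPoly, extensionPoly]
    refine (abs_add_le _ _).trans ?_
    rw [abs_mul, abs_mul, Nat.abs_cast]
    gcongr
    · exact ih j
    · exact ih (j + 1)

theorem summable_dobinski_prod (y u : ℝ) (j : ℕ) :
    Summable fun p : ℕ × ℕ =>
      y ^ p.1 / p.1.factorial * ((((p.1 : ℝ) + j) * u) ^ p.2 / p.2.factorial) := by
  rw [← summable_norm_iff]
  have hrow (i : ℕ) : HasSum
      (fun m : ℕ => ‖y ^ i / i.factorial * ((((i : ℝ) + j) * u) ^ m / m.factorial)‖)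
      (Real.exp (j * |u|) * ((|y| * Real.exp |u|) ^ i / i.factorial)) := by
    convert! (hasSum_pow_div_factorial (((i : ℝ) + j) * |u|)).mul_left (|y| ^ i / i.factorial)
      using 1
    · ext m
      have : |(i : ℝ) + j| = i + j := abs_of_nonneg (by positivity)
      simp [this]
    · rw [mul_pow, ← Real.exp_nat_mul, add_mul, Real.exp_add]
      ring
  refine (summable_prod_of_nonneg fun _ => norm_nonneg _).2 ⟨fun i => (hrow i).summable, ?_⟩
  simp only [(hrow _).tsum_eq]
  exact (Real.summable_pow_div_factorial _).mul_left _

theorem hasSum_extensionPoly (y u : ℝ) (j : ℕ) :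
    HasSum (fun m : ℕ => u ^ m / m.factorial * extensionPoly y m j)
      (Real.exp (j * u + y * (Real.exp u - 1))) := by
  obtain ⟨S, hS⟩ := summable_dobinski_prod y u j
  have hrows := hS.prod_fiberwise fun i =>
    (hasSum_pow_div_factorial (((i : ℝ) + j) * u)).mul_left (y ^ i / i.factorial)
  have hS' : S = Real.exp (j * u) * Real.exp (y * Real.exp u) := by
    refine hrows.unique ?_
    convert! (hasSum_pow_div_factorial (y * Real.exp u)).mul_left (Real.exp (j * u)) using 2 with i
    rw [mul_pow, ← Real.exp_nat_mul, add_mul, Real.exp_add]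
    ring
  have hcols := ((Equiv.prodComm ℕ ℕ).hasSum_iff.2 hS).prod_fiberwise fun m => by
    convert! (hasSum_dobinski y m j).mul_left (u ^ m / m.factorial) using 2 with i
    simp [mul_pow]
    ring
  convert! hcols.mul_left (Real.exp (-y)) using 1
  · ext m
    rw [mul_left_comm, ← mul_assoc (Real.exp (-y)), ← Real.exp_add]
    simp
  · rw [hS', ← Real.exp_add, ← Real.exp_add]
    ring_nf

theorem integral_pow_mul_sub_pow (x : ℝ) (j m : ℕ) :
    ∫ t in (0 : ℝ)..x, t ^ j / j.factorial * ((x - t) ^ m / m.factorial)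
      = x ^ (j + m + 1) / (j + m + 1).factorial := by
  induction j generalizing m with
  | zero =>
    simp [intervalIntegral.integral_comp_sub_left (fun t => t ^ m / (m.factorial : ℝ)) x,
      integral_pow, Nat.factorial_succ]
    field_simp
  | succ j ih =>
    have hderiv (t : ℝ) : HasDerivAt
        (fun t => t ^ (j + 1) / (j + 1).factorial * ((x - t) ^ (m + 1) / (m + 1).factorial))
        (t ^ j / j.factorial * ((x - t) ^ (m + 1) / (m + 1).factorial)
          - t ^ (j + 1) / (j + 1).factorial * ((x - t) ^ m / m.factorial)) t := by
      have h₁ := (hasDerivAt_pow (j + 1) t).div_const ((j + 1).factorial : ℝ)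
      have h₂ := (((hasDerivAt_id t).const_sub x).pow (m + 1)).div_const ((m + 1).factorial : ℝ)
      convert! h₁.mul h₂ using 1
      simp [Nat.factorial_succ]
      field_simp
      ring
    have hint := intervalIntegral.integral_eq_sub_of_hasDerivAt (a := 0) (b := x)
      (fun t _ => hderiv t) (Continuous.intervalIntegrable (by fun_prop) _ _)
    rw [intervalIntegral.integral_sub (Continuous.intervalIntegrable (by fun_prop) _ _)
      (Continuous.intervalIntegrable (by fun_prop) _ _), ih] at hint
    simp only [sub_self, ne_eq, Nat.add_eq_zero_iff, one_ne_zero, and_false, not_false_eq_true,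
      zero_pow, zero_div, mul_zero, zero_mul] at hint
    rw [← sub_eq_zero.1 hint, show j + (m + 1) + 1 = j + 1 + m + 1 by ring]

theorem summable_kernel (y a u s : ℝ) :
    Summable fun p : ℕ × ℕ =>
      a ^ p.1 * (s ^ p.1 / p.1.factorial * (u ^ p.2 / p.2.factorial)) *
        extensionPoly y p.2 (p.1 + 1) := by
  have hrow (j : ℕ) : HasSum
      (fun m : ℕ => |a| ^ j * (|s| ^ j / j.factorial * (|u| ^ m / m.factorial)) *
        extensionPoly |y| m (j + 1))
      (Real.exp (|u| + |y| * (Real.exp |u| - 1)) *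
        ((|a| * |s| * Real.exp |u|) ^ j / j.factorial)) := by
    convert! (hasSum_extensionPoly |y| |u| (j + 1)).mul_left (|a| ^ j * |s| ^ j / j.factorial)
      using 1
    · ext m
      ring
    · push_cast
      rw [mul_pow, mul_pow, ← Real.exp_nat_mul, add_mul, add_assoc, Real.exp_add (j * |u|), one_mul]
      ring
  refine Summable.of_norm_bounded (g := fun p : ℕ × ℕ =>
      |a| ^ p.1 * (|s| ^ p.1 / p.1.factorial * (|u| ^ p.2 / p.2.factorial)) *
        extensionPoly |y| p.2 (p.1 + 1)) ?_ fun p => ?_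
  · refine (summable_prod_of_nonneg fun p => ?_).2 ⟨fun j => (hrow j).summable, ?_⟩
    · have := extensionPoly_nonneg (abs_nonneg y) p.2 (p.1 + 1)
      positivity
    · simp only [(hrow _).tsum_eq]
      exact (Real.summable_pow_div_factorial _).mul_left _
  · simp only [Real.norm_eq_abs, abs_mul, abs_div, abs_pow, Nat.abs_cast]
    gcongr
    exact abs_extensionPoly_le y _ _

theorem hasSum_kernel (y a u s : ℝ) :
    HasSum (fun p : ℕ × ℕ =>
      a ^ p.1 * (s ^ p.1 / p.1.factorial * (u ^ p.2 / p.2.factorial)) *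
        extensionPoly y p.2 (p.1 + 1))
      (Real.exp (u + y * (Real.exp u - 1) + a * s * Real.exp u)) := by
  obtain ⟨S, hS⟩ := summable_kernel y a u s
  have hrows := hS.prod_fiberwise fun j => by
    convert! (hasSum_extensionPoly y u (j + 1)).mul_left (a ^ j * s ^ j / j.factorial) using 2 with m
    ring
  convert! hS
  refine HasSum.unique ?_ hrows
  rw [Real.exp_add]
  convert! (hasSum_pow_div_factorial (a * s * Real.exp u)).mul_left
    (Real.exp (u + y * (Real.exp u - 1))) using 2 with j
  push_cast
  rw [mul_pow, mul_pow, ← Real.exp_nat_mul, add_mul, add_assoc, Real.exp_add (j * u), one_mul]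
  ring

theorem hasSum_integral_kernel (x y a : ℝ) :
    HasSum (fun p : ℕ × ℕ =>
      a ^ p.1 * (x ^ (p.1 + p.2 + 1) / (p.1 + p.2 + 1).factorial) * extensionPoly y p.2 (p.1 + 1))
      (∫ t in (0 : ℝ)..x,
        Real.exp (x - t + y * (Real.exp (x - t) - 1) + a * t * Real.exp (x - t))) := by
  have h := intervalIntegral.hasSum_integral_of_dominated_convergence (μ := MeasureTheory.volume)
    (a := 0) (b := x)
    (F := fun (p : ℕ × ℕ) t => a ^ p.1 * (t ^ p.1 / p.1.factorial *
      ((x - t) ^ p.2 / p.2.factorial)) * extensionPoly y p.2 (p.1 + 1))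
    (f := fun t => Real.exp (x - t + y * (Real.exp (x - t) - 1) + a * t * Real.exp (x - t)))
    (fun p _ => ‖a ^ p.1 * (x ^ p.1 / p.1.factorial * (x ^ p.2 / p.2.factorial)) *
      extensionPoly y p.2 (p.1 + 1)‖)
    (fun p => Continuous.aestronglyMeasurable (by fun_prop))
    (fun p => Filter.Eventually.of_forall fun t ht => ?_)
    (Filter.Eventually.of_forall fun t _ => (summable_kernel y a x x).norm)
    intervalIntegrable_const
    (Filter.Eventually.of_forall fun t _ => hasSum_kernel y a (x - t) t)
  · convert! h using 2 with p
    rw [intervalIntegral.integral_mul_const, intervalIntegral.integral_const_mul,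
      integral_pow_mul_sub_pow]
  · obtain ⟨ht₁, ht₂⟩ : |t| ≤ |x| ∧ |x - t| ≤ |x| := by
      rcases Set.mem_uIoc.1 ht with h | h
      · rw [abs_of_nonneg (by linarith : 0 ≤ x)]
        constructor <;> rw [abs_le] <;> constructor <;> linarith
      · rw [abs_of_nonpos (by linarith : x ≤ 0)]
        constructor <;> rw [abs_le] <;> constructor <;> linarith
    simp only [Real.norm_eq_abs, abs_mul, abs_div, abs_pow, Nat.abs_cast]
    gcongr

theorem hasSum_integral_kernel_nat (x y q : ℝ) :
    HasSum (fun n : ℕ => x ^ n / n.factorial * ∑ j ∈ range n,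
        (q - 1) * q ^ j * y ^ (j + 1) * extensionPoly y (n - 1 - j) (j + 1))
      (∫ t in (0 : ℝ)..x,
        (q - 1) * y * Real.exp ((x - t) + (1 + q * t) * y * Real.exp (x - t) - y)) := by
  have hanti := ((HasAntidiagonal.sigmaAntidiagonalEquivProd (A := ℕ)).hasSum_iff.2
    (hasSum_integral_kernel x y (q * y))).sigma fun n => hasSum_fintype _
  rw [← hasSum_nat_add_iff' 1]
  convert! hanti.mul_left ((q - 1) * y) using 1
  · ext n
    simp only [Function.comp_apply, HasAntidiagonal.sigmaAntidiagonalEquivProd_apply, Nat.add_sub_cancel]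
    rw [univ_eq_attach, sum_attach (antidiagonal n) fun p : ℕ × ℕ =>
      (q * y) ^ p.1 * (x ^ (p.1 + p.2 + 1) / (p.1 + p.2 + 1).factorial) *
        extensionPoly y p.2 (p.1 + 1), Nat.sum_antidiagonal_eq_sum_range_succ_mk, mul_sum, mul_sum]
    refine sum_congr rfl fun j hj => ?_
    rw [Nat.add_sub_cancel' (Nat.lt_succ_iff.1 (mem_range.1 hj))]
    ring
  · rw [← intervalIntegral.integral_const_mul]
    simp only [sum_range_one, range_zero, sum_empty, mul_zero, sub_zero]
    congr with t
    ring_nf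

/-- The exponential generating function
`R(x,y;q) = Σ_n (xⁿ/n!) Σ_{k=0}^n y^k Σ_{π ∈ R_{n,k}} q^{F_π}` converges absolutely and equals
`e^{y(eˣ-1)} + ∫₀ˣ (q-1) y e^{(x-t) + (1+qt) y e^{x-t} - y} dt`. -/
theorem rgs_fixpoint_egf (x y q : ℝ) :
    Summable (fun n : ℕ => |x ^ n / n.factorial *
        ∑ k ∈ Finset.range (n + 1), y ^ k * ∑ π ∈ RGSk n k, q ^ fixCount π|) ∧
    ∑' n : ℕ, x ^ n / n.factorial *
        ∑ k ∈ Finset.range (n + 1), y ^ k * ∑ π ∈ RGSk n k, q ^ fixCount π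
      = Real.exp (y * (Real.exp x - 1))
        + ∫ t in (0:ℝ)..x,
            (q - 1) * y * Real.exp ((x - t) + (1 + q * t) * y * Real.exp (x - t) - y) := by
  have h : HasSum (fun n : ℕ => x ^ n / n.factorial *
      ∑ k ∈ Finset.range (n + 1), y ^ k * ∑ π ∈ RGSk n k, q ^ fixCount π)
      (Real.exp (y * (Real.exp x - 1)) + ∫ t in (0:ℝ)..x,
        (q - 1) * y * Real.exp ((x - t) + (1 + q * t) * y * Real.exp (x - t) - y)) := by
    simp only [sum_RGSk, mul_add]
    simpa using (hasSum_extensionPoly y x 0).add (hasSum_integral_kernel_nat x y q)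
  exact ⟨h.summable.abs, h.tsum_eq⟩
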